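/- Let k ≤ n−k be positive integers and let C ⊆ F_q^{k×(n−k)} be an F_q-linear subspace of dimension (n−k)(k−δ+1) in which every nonzero matrix has rank at least δ, and which contains a matrix of rank exactly δ. Then the lifted code 𝒞 = {rowspace[I_k A] : A ∈ C} is a set of q^{(n−k)(k−δ+1)} distinct k-dimensional subspaces of F_q^n, and the minimum subspace distance between distinct elements of 𝒞 is exactly 2δ. -/

import Mathlib

/-- Subspace distance `d_S(U,V) = dim U + dim V - 2 dim (U ∩ V)`. -/
noncomputable def sDist {F : Type*} [Field F] {n : ℕ}
    (U V : Submodule F (Fin n → F)) : ℕ :=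
  Module.finrank F U + Module.finrank F V - 2 * Module.finrank F ↥(U ⊓ V)

/-- Row space of a matrix: the span of its rows. -/
def rowSpace {F : Type*} [Field F] {k n : ℕ} (M : Matrix (Fin k) (Fin n) F) :
    Submodule F (Fin n → F) :=
  Submodule.span F (Set.range fun i : Fin k => M i)

/-- The lifting `[I_k  A]` of a `k × (n-k)` matrix `A`, as a `k × n` matrix. -/
def liftMat {F : Type*} [Field F] {k n : ℕ} (hkn : k ≤ n)
    (A : Matrix (Fin k) (Fin (n - k)) F) : Matrix (Fin k) (Fin n) F :=
  fun i j =>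
    if h : (j : ℕ) < k then (if (j : ℕ) = (i : ℕ) then 1 else 0)
    else A i ⟨(j : ℕ) - k, by have := j.isLt; omega⟩

section Lifting

variable {F : Type*} [Field F] {k n : ℕ}

theorem rowSpace_eq_range_vecMulLinear (M : Matrix (Fin k) (Fin n) F) :
    rowSpace M = LinearMap.range M.vecMulLinear :=
  (range_vecMulLinear M).symm

theorem vecMul_liftMat_castLE (h : k ≤ n) (A : Matrix (Fin k) (Fin (n - k)) F)
    (v : Fin k → F) (i : Fin k) :
    Matrix.vecMul v (liftMat h A) (Fin.castLE h i) = v i := by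
  simp [Matrix.vecMul, dotProduct, liftMat, Fin.val_inj]

theorem vecMul_liftMat_of_le (h : k ≤ n) (A : Matrix (Fin k) (Fin (n - k)) F)
    (v : Fin k → F) (j : Fin n) (hj : k ≤ j) :
    Matrix.vecMul v (liftMat h A) j =
      Matrix.vecMul v A ⟨j - k, Nat.sub_lt_sub_right hj j.isLt⟩ := by
  simp [Matrix.vecMul, dotProduct, liftMat, hj.not_gt]

theorem vecMulLinear_liftMat_injective (h : k ≤ n) (A : Matrix (Fin k) (Fin (n - k)) F) :
    Function.Injective (liftMat h A).vecMulLinear := by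
  intro v w hvw
  ext i
  simpa [vecMul_liftMat_castLE] using congrFun hvw (Fin.castLE h i)

theorem vecMul_liftMat_eq_iff (h : k ≤ n) (A B : Matrix (Fin k) (Fin (n - k)) F)
    (v w : Fin k → F) :
    Matrix.vecMul v (liftMat h A) = Matrix.vecMul w (liftMat h B) ↔
      v = w ∧ Matrix.vecMul v A = Matrix.vecMul w B := by
  constructor
  · intro e
    refine ⟨funext fun i => ?_, funext fun l => ?_⟩
    · simpa [vecMul_liftMat_castLE] using congrFun e (Fin.castLE h i)
    · have hl := congrFun e ⟨k + l, by omega⟩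
      rw [vecMul_liftMat_of_le h A v _ (Nat.le_add_right k l),
        vecMul_liftMat_of_le h B w _ (Nat.le_add_right k l)] at hl
      simpa using hl
  · rintro ⟨rfl, e⟩
    ext j
    rcases lt_or_ge (j : ℕ) k with hj | hj
    · exact (vecMul_liftMat_castLE h A v ⟨j, hj⟩).trans
        (vecMul_liftMat_castLE h B v ⟨j, hj⟩).symm
    · rw [vecMul_liftMat_of_le h A v j hj, vecMul_liftMat_of_le h B v j hj, e]

theorem finrank_rowSpace_liftMat (h : k ≤ n) (A : Matrix (Fin k) (Fin (n - k)) F) :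
    Module.finrank F (rowSpace (liftMat h A)) = k := by
  rw [rowSpace_eq_range_vecMulLinear,
    LinearMap.finrank_range_of_inj (vecMulLinear_liftMat_injective h A), Module.finrank_fin_fun]

theorem rowSpace_liftMat_inf (h : k ≤ n) (A B : Matrix (Fin k) (Fin (n - k)) F) :
    rowSpace (liftMat h A) ⊓ rowSpace (liftMat h B) =
      (LinearMap.ker (A - B).vecMulLinear).map (liftMat h A).vecMulLinear := by
  ext x
  simp only [rowSpace_eq_range_vecMulLinear, Submodule.mem_inf, LinearMap.mem_range,
    Submodule.mem_map, LinearMap.mem_ker, Matrix.vecMulLinear_apply, Matrix.vecMul_sub,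
    sub_eq_zero]
  constructor
  · rintro ⟨⟨v, rfl⟩, w, hw⟩
    obtain ⟨rfl, e⟩ := (vecMul_liftMat_eq_iff h B A w v).1 hw
    exact ⟨w, e.symm, rfl⟩
  · rintro ⟨v, e, rfl⟩
    exact ⟨⟨v, rfl⟩, v, (vecMul_liftMat_eq_iff h B A v v).2 ⟨rfl, e.symm⟩⟩

theorem finrank_ker_vecMulLinear_add_rank {m : ℕ} (M : Matrix (Fin k) (Fin m) F) :
    M.rank + Module.finrank F (LinearMap.ker M.vecMulLinear) = k := by
  rw [Matrix.rank_eq_finrank_span_row, ← range_vecMulLinear,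
    LinearMap.finrank_range_add_finrank_ker, Module.finrank_fin_fun]

theorem sDist_rowSpace_liftMat (h : k ≤ n) (A B : Matrix (Fin k) (Fin (n - k)) F) :
    sDist (rowSpace (liftMat h A)) (rowSpace (liftMat h B)) = 2 * (A - B).rank := by
  have hrank := finrank_ker_vecMulLinear_add_rank (A - B)
  rw [sDist, finrank_rowSpace_liftMat, finrank_rowSpace_liftMat, rowSpace_liftMat_inf,
    ← (Submodule.equivMapOfInjective _ (vecMulLinear_liftMat_injective h A) _).finrank_eq]
  omega

theorem rowSpace_liftMat_injective (h : k ≤ n) :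
    Function.Injective fun A : Matrix (Fin k) (Fin (n - k)) F => rowSpace (liftMat h A) := by
  intro A B (hAB : rowSpace (liftMat h A) = rowSpace (liftMat h B))
  refine Matrix.ext_iff_vecMul.2 fun v => ?_
  have hv : (liftMat h A).vecMulLinear v ∈ LinearMap.range (liftMat h B).vecMulLinear := by
    rw [← rowSpace_eq_range_vecMulLinear, ← hAB, rowSpace_eq_range_vecMulLinear]
    exact LinearMap.mem_range_self _ v
  obtain ⟨w, hw⟩ := hv
  obtain ⟨rfl, e⟩ := (vecMul_liftMat_eq_iff h B A w v).1 hw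
  exact e.symm

end Lifting

/-- lifting a `[k×(n-k), (n-k)(k-δ+1), δ]` rank-metric (MRD) code `C`
gives a constant dimension code `𝒞` consisting of `q^{(n-k)(k-δ+1)}` distinct
`k`-dimensional subspaces of `F_q^n`, with minimum subspace distance exactly `2δ`. -/
theorem lifted_MRD_is_constant_dimension_code
    {F : Type*} [Field F] [Fintype F] {k n δ : ℕ}
    (hk : 0 < k) (hkn : k ≤ n - k) (hδ1 : 1 ≤ δ) (hδk : δ ≤ k)
    (C : Submodule F (Matrix (Fin k) (Fin (n - k)) F))
    (hdim : Module.finrank F C = (n - k) * (k - δ + 1))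
    (hmin : ∀ A ∈ C, A ≠ 0 → δ ≤ A.rank)
    (hex : ∃ A ∈ C, A.rank = δ) :
    (∀ A ∈ C, Module.finrank F
        (rowSpace (liftMat (hkn.trans (Nat.sub_le n k)) A)) = k) ∧
    (∀ A ∈ C, ∀ B ∈ C, A ≠ B →
        rowSpace (liftMat (hkn.trans (Nat.sub_le n k)) A) ≠
        rowSpace (liftMat (hkn.trans (Nat.sub_le n k)) B)) ∧
    Set.ncard {U : Submodule F (Fin n → F) |
        ∃ A ∈ C, U = rowSpace (liftMat (hkn.trans (Nat.sub_le n k)) A)}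
      = Fintype.card F ^ ((n - k) * (k - δ + 1)) ∧
    (∀ A ∈ C, ∀ B ∈ C,
        rowSpace (liftMat (hkn.trans (Nat.sub_le n k)) A) ≠
          rowSpace (liftMat (hkn.trans (Nat.sub_le n k)) B) →
        2 * δ ≤ sDist (rowSpace (liftMat (hkn.trans (Nat.sub_le n k)) A))
          (rowSpace (liftMat (hkn.trans (Nat.sub_le n k)) B))) ∧
    (∃ A ∈ C, ∃ B ∈ C,
        rowSpace (liftMat (hkn.trans (Nat.sub_le n k)) A) ≠
          rowSpace (liftMat (hkn.trans (Nat.sub_le n k)) B) ∧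
        sDist (rowSpace (liftMat (hkn.trans (Nat.sub_le n k)) A))
          (rowSpace (liftMat (hkn.trans (Nat.sub_le n k)) B)) = 2 * δ) := by
  have h : k ≤ n := hkn.trans (Nat.sub_le n k)
  have hinj := rowSpace_liftMat_injective (F := F) h
  refine ⟨fun A _ => finrank_rowSpace_liftMat h A, fun A _ B _ hAB => hinj.ne hAB, ?_, ?_, ?_⟩
  · have himage : {U : Submodule F (Fin n → F) | ∃ A ∈ C, U = rowSpace (liftMat h A)} =
        (fun A => rowSpace (liftMat h A)) '' (C : Set (Matrix (Fin k) (Fin (n - k)) F)) := by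
      ext U
      simp [eq_comm]
    rw [himage, Set.ncard_image_of_injective _ hinj, ← Nat.card_coe_set_eq, ← hdim,
      ← Nat.card_eq_fintype_card]
    exact Module.natCard_eq_pow_finrank
  · intro A hA B hB hAB
    rw [sDist_rowSpace_liftMat]
    refine Nat.mul_le_mul_left 2 (hmin _ (C.sub_mem hA hB) (sub_ne_zero.2 ?_))
    rintro rfl
    exact hAB rfl
  · obtain ⟨A, hA, hrank⟩ := hex
    refine ⟨A, hA, 0, C.zero_mem, hinj.ne ?_, by rw [sDist_rowSpace_liftMat, sub_zero, hrank]⟩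
    rintro rfl
    rw [Matrix.rank_zero] at hrank
    omega
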